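/- Let p be a prime and n ≥ 2 an integer, and let r : GL_n(ℤ/p²ℤ) → GL_n(ℤ/pℤ) be the group homomorphism induced entrywise by the natural surjective ring homomorphism ℤ/p²ℤ → ℤ/pℤ. There exists a group homomorphism s : GL_n(ℤ/pℤ) → GL_n(ℤ/p²ℤ) with r ∘ s = id if and only if (p,n) = (3,2), (p,n) = (2,2), or (p,n) = (2,3). -/

import Mathlib

/-- The homomorphism `GL_n(ℤ/p²ℤ) → GL_n(ℤ/pℤ)` induced entrywise by the natural
surjective ring homomorphism `ℤ/p²ℤ → ℤ/pℤ`. -/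
noncomputable def glModSquareReduction (p n : ℕ) :
    GL (Fin n) (ZMod (p ^ 2)) →* GL (Fin n) (ZMod p) :=
  Matrix.GeneralLinearGroup.map (ZMod.castHom (dvd_pow_self p two_ne_zero) (ZMod p))

/-- Packed table for the section of `GL_3(ZMod 4) → GL_3(ZMod 2)`. -/
def secTab3 : ℕ := 1069704090089989035168825134702050400229193231878358834071020905845642838420956364916711150387908276129523843152412672606484144942179360437699150266434913778742076162974865359304235778932987452214407745274331205660710183522808872182110155845839419713958621718471715020945756471369929608308491556241125263843180973655590712763204962894511550111199144380779208489181321378319288615965594301413472624509516112964472186032512361605192336872020959479322300079087360798102766636468391431966735675984663675869348626736233768511875161401090731985768099234710847463099907923135230118865470609217101461454553625501370700073723326278815693016140406720345008932645050738215203961859171555173385438960144806811319057104349772450693917940431100476539051086941972855000014935370125280751521283729957690088420859493127007702524345282108778686611995976583861744800973689572807307839033183243661849674755739530476856211588617339344007013765393936018099015103262507360913474424273280691338034956365942428961876649359244555365212647046923497354849507868578919101591721263538484106079797140123618294486562911384508042735884664250362466703732496999334088391456487069954714037511463934399941264445139913596032099218889050061768402068651451032695841956208921438599023680362282052360984936885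7642342662240554979435783330628386460790252242557034631862354113777364927625879885880322162688

/-- Natural-number entry of the lifted matrix. -/
def secEnt3 (x c j : ℕ) : ℕ := x + 2 * (Nat.div secTab3 (Nat.pow 2 (9 * c + j)) % 2)

/-- Code of a 3×3 matrix with entries 0, 1. -/
def secCode3 (a b c d e f g h k : ℕ) : ℕ :=
  a + 2 * b + 4 * c + 8 * d + 16 * e + 32 * f + 64 * g + 128 * h + 256 * k

/-- Boolean test of the first row of a product in `ZMod 4`. -/
def secRow3 (c' : ℕ) (x0 x1 x2 : ℕ) (i : ℕ) (t0 t1 t2 : ℕ) (m : ℕ) (a b c d e f g h k : ℕ) : Bool :=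
  Nat.beq (secEnt3 x0 c' (3*i)) ((t0 * secEnt3 a m 0 + t1 * secEnt3 d m 3 + t2 * secEnt3 g m 6) % 4) &&
  Nat.beq (secEnt3 x1 c' (3*i+1)) ((t0 * secEnt3 b m 1 + t1 * secEnt3 e m 4 + t2 * secEnt3 h m 7) % 4) &&
  Nat.beq (secEnt3 x2 c' (3*i+2)) ((t0 * secEnt3 c m 2 + t1 * secEnt3 f m 5 + t2 * secEnt3 k m 8) % 4)

/-- Test of `sec (t * M) = sec t * sec M`, given the entries of `t * M`, of `t` and of `M`. -/
def secTest3 (a' b' c' d' e' f' g' h' k' t0 t1 t2 t3 t4 t5 t6 t7 t8 a b c d e f g h k : ℕ) : Bool :=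
  secRow3 (secCode3 a' b' c' d' e' f' g' h' k') a' b' c' 0
    (secEnt3 t0 (secCode3 t0 t1 t2 t3 t4 t5 t6 t7 t8) 0)
    (secEnt3 t1 (secCode3 t0 t1 t2 t3 t4 t5 t6 t7 t8) 1)
    (secEnt3 t2 (secCode3 t0 t1 t2 t3 t4 t5 t6 t7 t8) 2) (secCode3 a b c d e f g h k) a b c d e f g h k &&
  secRow3 (secCode3 a' b' c' d' e' f' g' h' k') d' e' f' 1
    (secEnt3 t3 (secCode3 t0 t1 t2 t3 t4 t5 t6 t7 t8) 3)
    (secEnt3 t4 (secCode3 t0 t1 t2 t3 t4 t5 t6 t7 t8) 4)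
    (secEnt3 t5 (secCode3 t0 t1 t2 t3 t4 t5 t6 t7 t8) 5) (secCode3 a b c d e f g h k) a b c d e f g h k &&
  secRow3 (secCode3 a' b' c' d' e' f' g' h' k') g' h' k' 2
    (secEnt3 t6 (secCode3 t0 t1 t2 t3 t4 t5 t6 t7 t8) 6)
    (secEnt3 t7 (secCode3 t0 t1 t2 t3 t4 t5 t6 t7 t8) 7)
    (secEnt3 t8 (secCode3 t0 t1 t2 t3 t4 t5 t6 t7 t8) 8) (secCode3 a b c d e f g h k) a b c d e f g h k

/-- The test for all invertible matrices and the three transvections. -/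
def secAll3 (a b c d e f g h k : ℕ) : Bool :=
  !(Nat.beq ((a * e * k + a * f * h + b * d * k + b * f * g + c * d * h + c * e * g) % 2) 1) ||
  (secTest3 ((a+d)%2) ((b+e)%2) ((c+f)%2) d e f g h k 1 1 0 0 1 0 0 0 1 a b c d e f g h k &&
   secTest3 a b c ((d+g)%2) ((e+h)%2) ((f+k)%2) g h k 1 0 0 0 1 1 0 0 1 a b c d e f g h k &&
   secTest3 a b c d e f ((g+a)%2) ((h+b)%2) ((k+c)%2) 1 0 0 0 1 0 1 0 1 a b c d e f g h k)

/-- Test both values of a bit. -/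
def secBoth (F : ℕ → Bool) : Bool := F 0 && F 1

lemma secBoth_spec {F : ℕ → Bool} (h : secBoth F = true) (a : ZMod 2) : F a.val = true := by
  simp only [secBoth, Bool.and_eq_true] at h
  fin_cases a
  · exact h.1
  · exact h.2

lemma secAll3_bits : (secBoth fun a => secBoth fun b => secBoth fun c => secBoth fun d =>
    secBoth fun e => secBoth fun f => secBoth fun g => secBoth fun h => secBoth fun k =>
      secAll3 a b c d e f g h k) = true := by
  decide +kernel

/-- The set-theoretic section for `(2,3)`. -/
def sec3 (M : Matrix (Fin 3) (Fin 3) (ZMod 2)) : Matrix (Fin 3) (Fin 3) (ZMod (2 ^ 2)) :=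
  Matrix.of fun i j => ((secEnt3 (M i j).val (secCode3 (M 0 0).val (M 0 1).val (M 0 2).val
    (M 1 0).val (M 1 1).val (M 1 2).val (M 2 0).val (M 2 1).val (M 2 2).val)
    (3 * i.val + j.val) : ℕ) : ZMod (2 ^ 2))

lemma sec_cast_aux {x y : ℕ} (h : x = y % 4) : (x : ZMod (2 ^ 2)) = (y : ZMod (2 ^ 2)) := by
  rw [ZMod.natCast_eq_natCast_iff', h]
  norm_num

lemma sec3_of_test (M' T M : Matrix (Fin 3) (Fin 3) (ZMod 2))
    (h : secTest3 (M' 0 0).val (M' 0 1).val (M' 0 2).val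
      (M' 1 0).val (M' 1 1).val (M' 1 2).val (M' 2 0).val (M' 2 1).val (M' 2 2).val
      (T 0 0).val (T 0 1).val (T 0 2).val
      (T 1 0).val (T 1 1).val (T 1 2).val (T 2 0).val (T 2 1).val (T 2 2).val
      (M 0 0).val (M 0 1).val (M 0 2).val
      (M 1 0).val (M 1 1).val (M 1 2).val (M 2 0).val (M 2 1).val (M 2 2).val = true) :
    sec3 M' = sec3 T * sec3 M := by
  simp only [secTest3, secRow3, Bool.and_eq_true, Nat.beq_eq] at h
  obtain ⟨⟨⟨⟨h0, h1⟩, h2⟩, ⟨h3, h4⟩, h5⟩, ⟨h6, h7⟩, h8⟩ := h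
  ext i j
  rw [Matrix.mul_apply, Fin.sum_univ_three]
  fin_cases i <;> fin_cases j
  · simpa [sec3] using sec_cast_aux h0
  · simpa [sec3] using sec_cast_aux h1
  · simpa [sec3] using sec_cast_aux h2
  · simpa [sec3] using sec_cast_aux h3
  · simpa [sec3] using sec_cast_aux h4
  · simpa [sec3] using sec_cast_aux h5
  · simpa [sec3] using sec_cast_aux h6
  · simpa [sec3] using sec_cast_aux h7
  · simpa [sec3] using sec_cast_aux h8

lemma sec3_gens (M : Matrix (Fin 3) (Fin 3) (ZMod 2)) (hM : M.det ≠ 0) :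
    sec3 (!![1, 1, 0; 0, 1, 0; 0, 0, 1] * M) = sec3 !![1, 1, 0; 0, 1, 0; 0, 0, 1] * sec3 M ∧
    sec3 (!![1, 0, 0; 0, 1, 1; 0, 0, 1] * M) = sec3 !![1, 0, 0; 0, 1, 1; 0, 0, 1] * sec3 M ∧
    sec3 (!![1, 0, 0; 0, 1, 0; 1, 0, 1] * M) = sec3 !![1, 0, 0; 0, 1, 0; 1, 0, 1] * sec3 M := by
  have h := secBoth_spec (secBoth_spec (secBoth_spec (secBoth_spec (secBoth_spec (secBoth_spec
    (secBoth_spec (secBoth_spec (secBoth_spec secAll3_bits (M 0 0)) (M 0 1)) (M 0 2)) (M 1 0))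
    (M 1 1)) (M 1 2)) (M 2 0)) (M 2 1)) (M 2 2)
  have hd : ((M 0 0).val * (M 1 1).val * (M 2 2).val + (M 0 0).val * (M 1 2).val * (M 2 1).val
      + (M 0 1).val * (M 1 0).val * (M 2 2).val + (M 0 1).val * (M 1 2).val * (M 2 0).val
      + (M 0 2).val * (M 1 0).val * (M 2 1).val + (M 0 2).val * (M 1 1).val * (M 2 0).val) % 2
      = 1 := by
    by_contra hne
    have h0 := Nat.mod_two_ne_one.1 hne
    apply hM
    have := (ZMod.natCast_eq_zero_iff _ 2).2 (Nat.dvd_of_mod_eq_zero h0)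
    push_cast at this
    simp only [ZMod.natCast_zmod_val] at this
    rw [Matrix.det_fin_three, ← this]
    simp only [CharTwo.sub_eq_add]
  rw [secAll3, hd] at h
  have hb : Nat.beq 1 1 = true := rfl
  simp only [hb, Bool.not_true, Bool.false_or, Bool.and_eq_true] at h
  obtain ⟨⟨h1, h2⟩, h3⟩ := h
  refine ⟨sec3_of_test _ _ _ ?_, sec3_of_test _ _ _ ?_, sec3_of_test _ _ _ ?_⟩
  · simpa [Matrix.mul_apply, Fin.sum_univ_three, ZMod.val_add, ZMod.val_one] using h1
  · simpa [Matrix.mul_apply, Fin.sum_univ_three, ZMod.val_add, ZMod.val_one] using h2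
  · simpa [Matrix.mul_apply, Fin.sum_univ_three, ZMod.val_add, ZMod.val_one, add_comm] using h3

/-- Left multiplicativity. -/
def SecGood3 (A : Matrix (Fin 3) (Fin 3) (ZMod 2)) : Prop :=
  A.det ≠ 0 ∧ ∀ M : Matrix (Fin 3) (Fin 3) (ZMod 2), M.det ≠ 0 → sec3 (A * M) = sec3 A * sec3 M

lemma SecGood3.mul {A B} (hA : SecGood3 A) (hB : SecGood3 B) : SecGood3 (A * B) := by
  refine ⟨by rw [Matrix.det_mul]; exact mul_ne_zero hA.1 hB.1, fun M hM => ?_⟩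
  rw [mul_assoc, hA.2 _ (by rw [Matrix.det_mul]; exact mul_ne_zero hB.1 hM), hB.2 _ hM, hA.2 _ hB.1,
    mul_assoc]

lemma sec3_one : sec3 1 = 1 := by decide +kernel

lemma SecGood3.one : SecGood3 1 := ⟨by simp, fun M _ => by simp [sec3_one]⟩

lemma secGood3_all (A : Matrix (Fin 3) (Fin 3) (ZMod 2)) (hA : A.det ≠ 0) : SecGood3 A := by
  have h12 : SecGood3 !![1, 1, 0; 0, 1, 0; 0, 0, 1] :=
    ⟨by decide +kernel, fun M hM => (sec3_gens M hM).1⟩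
  have h23 : SecGood3 !![1, 0, 0; 0, 1, 1; 0, 0, 1] :=
    ⟨by decide +kernel, fun M hM => (sec3_gens M hM).2.1⟩
  have h31 : SecGood3 !![1, 0, 0; 0, 1, 0; 1, 0, 1] :=
    ⟨by decide +kernel, fun M hM => (sec3_gens M hM).2.2⟩
  have h13 := (h12.mul h23).mul (h12.mul h23)
  have h21 := (h23.mul h31).mul (h23.mul h31)
  have h32 := (h31.mul h12).mul (h31.mul h12)
  refine Matrix.diagonal_transvection_induction_of_det_ne_zero SecGood3 A hA ?_ ?_ ?_
  · intro D hD
    have : D = 1 := by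
      rw [Matrix.det_diagonal, Finset.prod_ne_zero_iff] at hD
      ext i
      have := hD i (Finset.mem_univ _)
      rw [Pi.one_apply]
      generalize D i = x at this
      revert x
      decide +kernel
    rw [this]
    simpa [Matrix.diagonal_one] using SecGood3.one
  · rintro ⟨i, j, hij, c⟩
    have hc : c = 0 ∨ c = 1 := by revert c; decide +kernel
    rcases hc with rfl | rfl
    · simpa [Matrix.TransvectionStruct.toMatrix] using SecGood3.one
    · simp only [Matrix.TransvectionStruct.toMatrix]
      fin_cases i <;> fin_cases j
      · exact absurd rfl hij
      · convert h12 using 1; decide +kernel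
      · convert h13 using 1; decide +kernel
      · convert h21 using 1; decide +kernel
      · exact absurd rfl hij
      · convert h23 using 1; decide +kernel
      · convert h31 using 1; decide +kernel
      · convert h32 using 1; decide +kernel
      · exact absurd rfl hij
  · intro A B _ _ hA hB
    exact hA.mul hB

lemma gl_det_ne_zero {F : Type*} [Field F] {n : ℕ} (g : GL (Fin n) F) : g.1.det ≠ 0 := by
  have := g.isUnit
  rw [Matrix.isUnit_iff_isUnit_det] at this
  exact this.ne_zero

/-- Existence of a section from a multiplicative map on matrices. -/
lemma split_of_fun (p n : ℕ)
    (f : Matrix (Fin n) (Fin n) (ZMod p) → Matrix (Fin n) (Fin n) (ZMod (p ^ 2)))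
    (h1 : f 1 = 1)
    (hmul : ∀ A B : GL (Fin n) (ZMod p), f (A.1 * B.1) = f A.1 * f B.1)
    (hred : ∀ A : Matrix (Fin n) (Fin n) (ZMod p), ∀ i j,
      ZMod.castHom (dvd_pow_self p two_ne_zero) (ZMod p) (f A i j) = A i j) :
    ∃ s : GL (Fin n) (ZMod p) →* GL (Fin n) (ZMod (p ^ 2)),
        (glModSquareReduction p n).comp s = MonoidHom.id (GL (Fin n) (ZMod p)) := by
  let s0 : GL (Fin n) (ZMod p) →* Matrix (Fin n) (Fin n) (ZMod (p ^ 2)) :=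
    { toFun := fun g => f g.1
      map_one' := h1
      map_mul' := fun A B => hmul A B }
  refine ⟨s0.toHomUnits, ?_⟩
  ext g i j
  exact hred g.1 i j

lemma split_two_three : ∃ s : GL (Fin 3) (ZMod 2) →* GL (Fin 3) (ZMod (2 ^ 2)),
        (glModSquareReduction 2 3).comp s = MonoidHom.id (GL (Fin 3) (ZMod 2)) := by
  have : Fact (Nat.Prime 2) := ⟨Nat.prime_two⟩
  refine split_of_fun 2 3 sec3 sec3_one ?_ ?_
  · intro A B
    exact (secGood3_all A.1 (gl_det_ne_zero A)).2 _ (gl_det_ne_zero B)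
  · intro A i j
    simp only [sec3, Matrix.of_apply, secEnt3, map_natCast]
    push_cast
    have : (2 : ZMod 2) = 0 := rfl
    simp [this]

/-- Packed table for the section of `GL_2(ZMod 9) → GL_2(ZMod 3)`. -/
def secTab2 : ℕ := 37969177422245475999088413891390055151998599730358485295433183613278158871247609830651376452009575891115435021907628143697960358207025431114362373530500449878487581393400231559310250659020800

/-- Code of a 2×2 matrix over `ZMod 3`. -/
def secCode2 (M : Matrix (Fin 2) (Fin 2) (ZMod 3)) : ℕ :=
  8 * ((M 0 0).val + 3 * (M 0 1).val + 9 * (M 1 0).val + 27 * (M 1 1).val)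

/-- The set-theoretic section for `(3,2)`. -/
def sec2 (M : Matrix (Fin 2) (Fin 2) (ZMod 3)) : Matrix (Fin 2) (Fin 2) (ZMod (3 ^ 2)) :=
  Matrix.of fun i j => (((M i j).val + 3 * ((secTab2 / 2 ^ (secCode2 M + 2 * (2 * i.val + j.val))) % 4) : ℕ) :
    ZMod (3 ^ 2))

lemma sec2_transv : ∀ (i j : Fin 2) (t : ZMod 3), i ≠ j → ∀ a b c d : ZMod 3, a * d - b * c ≠ 0 →
    sec2 (Matrix.transvection i j t * !![a, b; c, d]) =
      sec2 (Matrix.transvection i j t) * sec2 !![a, b; c, d] := by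
  decide +kernel

lemma sec2_diag : ∀ (x y : ZMod 3), x * y ≠ 0 → ∀ a b c d : ZMod 3, a * d - b * c ≠ 0 →
    sec2 (!![x, 0; 0, y] * !![a, b; c, d]) =
      sec2 !![x, 0; 0, y] * sec2 !![a, b; c, d] := by
  decide +kernel

/-- Left multiplicativity. -/
def SecGood2 (A : Matrix (Fin 2) (Fin 2) (ZMod 3)) : Prop :=
  A.det ≠ 0 ∧ ∀ M : Matrix (Fin 2) (Fin 2) (ZMod 3), M.det ≠ 0 → sec2 (A * M) = sec2 A * sec2 M

lemma SecGood2.mul [Fact (Nat.Prime 3)] {A B} (hA : SecGood2 A) (hB : SecGood2 B) :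
    SecGood2 (A * B) := by
  refine ⟨by rw [Matrix.det_mul]; exact mul_ne_zero hA.1 hB.1, fun M hM => ?_⟩
  rw [mul_assoc, hA.2 _ (by rw [Matrix.det_mul]; exact mul_ne_zero hB.1 hM), hB.2 _ hM, hA.2 _ hB.1,
    mul_assoc]

lemma sec2_one : sec2 1 = 1 := by decide +kernel

lemma secGood2_all [Fact (Nat.Prime 3)] (A : Matrix (Fin 2) (Fin 2) (ZMod 3)) (hA : A.det ≠ 0) :
    SecGood2 A := by
  refine Matrix.diagonal_transvection_induction_of_det_ne_zero SecGood2 A hA ?_ ?_ ?_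
  · intro D hD
    refine ⟨hD, fun M hM => ?_⟩
    have e : Matrix.diagonal D = !![D 0, 0; 0, D 1] := by
      ext i j; fin_cases i <;> fin_cases j <;> simp
    rw [e] at hD ⊢
    rw [Matrix.eta_fin_two M] at hM ⊢
    rw [Matrix.det_fin_two_of] at hM hD
    exact sec2_diag _ _ (by simpa using hD) _ _ _ _ hM
  · rintro ⟨i, j, hij, c⟩
    refine ⟨by simp [Matrix.TransvectionStruct.toMatrix, Matrix.det_transvection_of_ne _ _ hij], fun M hM => ?_⟩
    rw [Matrix.eta_fin_two M] at hM ⊢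
    rw [Matrix.det_fin_two_of] at hM
    exact sec2_transv i j c hij _ _ _ _ hM
  · intro A B _ _ hA hB
    exact hA.mul hB

lemma split_three_two : ∃ s : GL (Fin 2) (ZMod 3) →* GL (Fin 2) (ZMod (3 ^ 2)),
        (glModSquareReduction 3 2).comp s = MonoidHom.id (GL (Fin 2) (ZMod 3)) := by
  have : Fact (Nat.Prime 3) := ⟨Nat.prime_three⟩
  refine split_of_fun 3 2 sec2 sec2_one ?_ ?_
  · intro A B
    exact (secGood2_all A.1 (gl_det_ne_zero A)).2 _ (gl_det_ne_zero B)
  · intro A i j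
    simp only [sec2, Matrix.of_apply, map_natCast]
    push_cast
    have : (3 : ZMod 3) = 0 := rfl
    simp [this]

lemma exists_of_cast_zero {p : ℕ} (hp : p.Prime) {x : ZMod (p ^ 2)} {h : p ∣ p ^ 2}
    (hx : ZMod.castHom h (ZMod p) x = 0) : ∃ y : ZMod (p ^ 2), x = (p : ZMod (p ^ 2)) * y := by
  have : NeZero (p ^ 2) := ⟨pow_ne_zero _ hp.ne_zero⟩
  rw [← ZMod.natCast_zmod_val x, map_natCast, ZMod.natCast_eq_zero_iff] at hx
  obtain ⟨c, hc⟩ := hx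
  refine ⟨c, ?_⟩
  rw [← ZMod.natCast_zmod_val x, hc]
  push_cast
  ring

lemma p_mul_p (p : ℕ) : (p : ZMod (p ^ 2)) * p = 0 := by
  rw [← Nat.cast_mul, ← sq, ZMod.natCast_self]

lemma mul_eq_zero_of_cast {p : ℕ} (hp : p.Prime) {x y : ZMod (p ^ 2)} {h : p ∣ p ^ 2}
    (hx : ZMod.castHom h (ZMod p) x = 0) (hy : ZMod.castHom h (ZMod p) y = 0) : x * y = 0 := by
  obtain ⟨a, rfl⟩ := exists_of_cast_zero hp hx
  obtain ⟨b, rfl⟩ := exists_of_cast_zero hp hy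
  linear_combination a * b * p_mul_p p

/-- Embedding of matrices as upper left block. -/
def embMat (R : Type*) [CommRing R] (n : ℕ) :
    Matrix (Fin n) (Fin n) R →* Matrix (Fin (n + 1)) (Fin (n + 1)) R where
  toFun M := (Matrix.fromBlocks M 0 0 1).submatrix (finSumFinEquiv (m := n) (n := 1)).symm
    (finSumFinEquiv (m := n) (n := 1)).symm
  map_one' := by simp
  map_mul' A B := by
    rw [Matrix.submatrix_mul_equiv, Matrix.fromBlocks_multiply]
    simp

lemma embMat_cast {R : Type*} [CommRing R] {n : ℕ} (M : Matrix (Fin n) (Fin n) R) (i j : Fin n) :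
    embMat R n M i.castSucc j.castSucc = M i j := by
  have h : ∀ i : Fin n, i.castSucc = finSumFinEquiv (m := n) (n := 1) (Sum.inl i) := by
    intro i; rfl
  simp only [embMat, MonoidHom.coe_mk, OneHom.coe_mk, Matrix.submatrix_apply, h,
    Equiv.symm_apply_apply, Matrix.fromBlocks_apply₁₁]

lemma embMat_last {R : Type*} [CommRing R] {n : ℕ} (M : Matrix (Fin n) (Fin n) R) (i : Fin n) :
    embMat R n M i.castSucc (Fin.last n) = 0 ∧ embMat R n M (Fin.last n) i.castSucc = 0 := by
  have h : ∀ i : Fin n, i.castSucc = finSumFinEquiv (m := n) (n := 1) (Sum.inl i) := by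
    intro i; rfl
  have h' : Fin.last n = finSumFinEquiv (m := n) (n := 1) (Sum.inr 0) := by
    ext; simp
  constructor <;>
  simp only [embMat, MonoidHom.coe_mk, OneHom.coe_mk, Matrix.submatrix_apply, h, h',
    Equiv.symm_apply_apply, Matrix.fromBlocks_apply₁₂, Matrix.fromBlocks_apply₂₁,
    Matrix.zero_apply]

/-- The reduction splits. -/
def GLSplits (p n : ℕ) : Prop := ∃ s : GL (Fin n) (ZMod p) →* GL (Fin n) (ZMod (p ^ 2)),
        (glModSquareReduction p n).comp s = MonoidHom.id (GL (Fin n) (ZMod p))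

lemma sec_entry {p n : ℕ} {s : GL (Fin n) (ZMod p) →* GL (Fin n) (ZMod (p ^ 2))}
    (hs : (glModSquareReduction p n).comp s = MonoidHom.id (GL (Fin n) (ZMod p)))
    (g : GL (Fin n) (ZMod p)) (i j : Fin n) :
    ZMod.castHom (dvd_pow_self p two_ne_zero) (ZMod p) ((s g).1 i j) = g.1 i j := by
  have := congrArg (fun u : GL (Fin n) (ZMod p) => u.1 i j) (DFunLike.congr_fun hs g)
  exact this

lemma GLSplits.pred {p n : ℕ} (hp : p.Prime) (h : GLSplits p (n + 1)) : GLSplits p n := by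
  obtain ⟨s, hs⟩ := h
  let e : GL (Fin n) (ZMod p) →* GL (Fin (n + 1)) (ZMod p) := Units.map (embMat (ZMod p) n)
  let s0 : GL (Fin n) (ZMod p) →* Matrix (Fin n) (Fin n) (ZMod (p ^ 2)) :=
    { toFun := fun g => (s (e g)).1.submatrix Fin.castSucc Fin.castSucc
      map_one' := by
        rw [map_one, map_one]
        exact Matrix.submatrix_one _ (Fin.castSucc_injective n)
      map_mul' := fun A B => by
        ext i j
        rw [map_mul, map_mul, Matrix.mul_apply]
        simp only [Matrix.submatrix_apply, Units.val_mul]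
        rw [Matrix.mul_apply, Fin.sum_univ_castSucc, mul_eq_zero_of_cast hp, add_zero]
        · exact (sec_entry hs (e A) _ _).trans (embMat_last A.1 i).1
        · exact (sec_entry hs (e B) _ _).trans (embMat_last B.1 j).2 }
  refine ⟨s0.toHomUnits, ?_⟩
  ext g i j
  exact (sec_entry hs (e g) i.castSucc j.castSucc).trans (embMat_cast g.1 i j)

lemma GLSplits.mono {p m n : ℕ} (hp : p.Prime) (hmn : m ≤ n) (h : GLSplits p n) : GLSplits p m := by
  induction n, hmn using Nat.le_induction with
  | base => exact h
  | succ k _ ih => exact ih (h.pred hp)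

/-- An entry of a lift, written as `c + p * y`. -/
lemma sec_entry' {p n : ℕ} (hp : p.Prime) {s : GL (Fin n) (ZMod p) →* GL (Fin n) (ZMod (p ^ 2))}
    (hs : (glModSquareReduction p n).comp s = MonoidHom.id (GL (Fin n) (ZMod p)))
    (g : GL (Fin n) (ZMod p)) (c : Fin n → Fin n → ℕ) (hc : ∀ i j, g.1 i j = (c i j : ZMod p)) :
    ∃ x : Fin n → Fin n → ZMod (p ^ 2), ∀ i j, (s g).1 i j = (c i j : ZMod (p ^ 2)) + (p : ZMod (p ^ 2)) * x i j := by
  have : ∀ i j, ∃ y, (s g).1 i j - (c i j : ZMod (p ^ 2)) = (p : ZMod (p ^ 2)) * y := by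
    intro i j
    apply exists_of_cast_zero hp (h := dvd_pow_self p two_ne_zero)
    rw [map_sub, sec_entry hs, hc, map_natCast, sub_self]
  choose x hx using this
  exact ⟨x, fun i j => by rw [← hx]; ring⟩

lemma aux_three {R : Type*} [CommRing R] (h9 : (9 : R) = 0) (A B : Matrix (Fin 3) (Fin 3) R)
    (x y : Fin 3 → Fin 3 → R)
    (hx : ∀ i j, A i j = (((!![1, 1, 0; 0, 1, 0; 0, 0, 1] :
      Matrix (Fin 3) (Fin 3) ℕ) i j : ℕ) : R) + ((3 : ℕ) : R) * x i j)
    (hy : ∀ i j, B i j = (((!![1, 0, 1; 0, 1, 0; 0, 0, 1] :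
      Matrix (Fin 3) (Fin 3) ℕ) i j : ℕ) : R) + ((3 : ℕ) : R) * y i j)
    (h1 : A * A * A = 1) (h2 : A * B = B * A) : (3 : R) = 0 := by
  have e1 := congrFun (congrFun h1 0) 1
  have e2 := congrFun (congrFun h2 1) 2
  simp only [Matrix.mul_apply, Fin.sum_univ_three, hx, hy] at e1 e2
  simp at e1 e2
  grind

lemma aux_two {R : Type*} [CommRing R] (h4 : (4 : R) = 0) (A B : Matrix (Fin 4) (Fin 4) R)
    (x y : Fin 4 → Fin 4 → R)
    (hx : ∀ i j, A i j = (((!![1, 0, 0, 1; 0, 1, 1, 0; 0, 0, 1, 0; 0, 0, 0, 1] :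
      Matrix (Fin 4) (Fin 4) ℕ) i j : ℕ) : R) + ((2 : ℕ) : R) * x i j)
    (hy : ∀ i j, B i j = (((!![1, 0, 1, 0; 0, 1, 1, 1; 0, 0, 1, 0; 0, 0, 0, 1] :
      Matrix (Fin 4) (Fin 4) ℕ) i j : ℕ) : R) + ((2 : ℕ) : R) * y i j)
    (h1 : A * A = 1) (h2 : B * B = 1) (h3 : A * B = B * A) : (2 : R) = 0 := by
  have e1 := congrFun (congrFun h1 0) 2
  have e2 := congrFun (congrFun h1 1) 2
  have e3 := congrFun (congrFun h1 1) 3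
  have e4 := congrFun (congrFun h2 0) 2
  have e5 := congrFun (congrFun h2 0) 3
  have e6 := congrFun (congrFun h2 1) 3
  have e7 := congrFun (congrFun h3 0) 3
  have e8 := congrFun (congrFun h3 1) 2
  simp only [Matrix.mul_apply, Fin.sum_univ_four, hx, hy] at e1 e2 e3 e4 e5 e6 e7 e8
  simp at e1 e2 e3 e4 e5 e6 e7 e8
  grind

lemma not_splits_three : ¬ GLSplits 3 3 := by
  rintro ⟨s, hs⟩
  let a : GL (Fin 3) (ZMod 3) := ⟨!![1, 1, 0; 0, 1, 0; 0, 0, 1], !![1, 2, 0; 0, 1, 0; 0, 0, 1],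
    by decide +kernel, by decide +kernel⟩
  let b : GL (Fin 3) (ZMod 3) := ⟨!![1, 0, 1; 0, 1, 0; 0, 0, 1], !![1, 0, 2; 0, 1, 0; 0, 0, 1],
    by decide +kernel, by decide +kernel⟩
  have ha : a * a * a = 1 := by
    apply Units.ext
    change !![1, 1, 0; 0, 1, 0; 0, 0, 1] * !![1, 1, 0; 0, 1, 0; 0, 0, 1] * !![1, 1, 0; 0, 1, 0; 0, 0, 1] = (1 : Matrix (Fin 3) (Fin 3) (ZMod 3))
    decide +kernel
  have hab : a * b = b * a := by
    apply Units.ext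
    change !![1, 1, 0; 0, 1, 0; 0, 0, 1] * !![1, 0, 1; 0, 1, 0; 0, 0, 1] =
      !![1, 0, 1; 0, 1, 0; 0, 0, 1] * (!![1, 1, 0; 0, 1, 0; 0, 0, 1] : Matrix (Fin 3) (Fin 3) (ZMod 3))
    decide +kernel
  obtain ⟨x, hx⟩ := sec_entry' Nat.prime_three hs a !![1, 1, 0; 0, 1, 0; 0, 0, 1]
    (fun i j => by fin_cases i <;> fin_cases j <;> rfl)
  obtain ⟨y, hy⟩ := sec_entry' Nat.prime_three hs b !![1, 0, 1; 0, 1, 0; 0, 0, 1]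
    (fun i j => by fin_cases i <;> fin_cases j <;> rfl)
  have h1 : (s a).1 * (s a).1 * (s a).1 = 1 := by
    rw [← Units.val_mul, ← Units.val_mul, ← map_mul, ← map_mul, ha, map_one]; rfl
  have h2 : (s a).1 * (s b).1 = (s b).1 * (s a).1 := by
    rw [← Units.val_mul, ← Units.val_mul, ← map_mul, ← map_mul, hab]
  exact absurd (aux_three (R := ZMod (3 ^ 2)) rfl _ _ x y hx hy h1 h2) (by decide)

lemma not_splits_two : ¬ GLSplits 2 4 := by
  rintro ⟨s, hs⟩
  let a : GL (Fin 4) (ZMod 2) := ⟨!![1, 0, 0, 1; 0, 1, 1, 0; 0, 0, 1, 0; 0, 0, 0, 1],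
    !![1, 0, 0, 1; 0, 1, 1, 0; 0, 0, 1, 0; 0, 0, 0, 1], by decide +kernel, by decide +kernel⟩
  let b : GL (Fin 4) (ZMod 2) := ⟨!![1, 0, 1, 0; 0, 1, 1, 1; 0, 0, 1, 0; 0, 0, 0, 1],
    !![1, 0, 1, 0; 0, 1, 1, 1; 0, 0, 1, 0; 0, 0, 0, 1], by decide +kernel, by decide +kernel⟩
  have ha : a * a = 1 := Units.ext a.val_inv
  have hb : b * b = 1 := Units.ext b.val_inv
  have hab : a * b = b * a := by
    apply Units.ext
    change !![1, 0, 0, 1; 0, 1, 1, 0; 0, 0, 1, 0; 0, 0, 0, 1] *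
      !![1, 0, 1, 0; 0, 1, 1, 1; 0, 0, 1, 0; 0, 0, 0, 1] =
      !![1, 0, 1, 0; 0, 1, 1, 1; 0, 0, 1, 0; 0, 0, 0, 1] *
      (!![1, 0, 0, 1; 0, 1, 1, 0; 0, 0, 1, 0; 0, 0, 0, 1] : Matrix (Fin 4) (Fin 4) (ZMod 2))
    decide +kernel
  obtain ⟨x, hx⟩ := sec_entry' Nat.prime_two hs a
    !![1, 0, 0, 1; 0, 1, 1, 0; 0, 0, 1, 0; 0, 0, 0, 1]
    (fun i j => by fin_cases i <;> fin_cases j <;> rfl)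
  obtain ⟨y, hy⟩ := sec_entry' Nat.prime_two hs b
    !![1, 0, 1, 0; 0, 1, 1, 1; 0, 0, 1, 0; 0, 0, 0, 1]
    (fun i j => by fin_cases i <;> fin_cases j <;> rfl)
  have h1 : (s a).1 * (s a).1 = 1 := by
    rw [← Units.val_mul, ← map_mul, ha, map_one]; rfl
  have h2 : (s b).1 * (s b).1 = 1 := by
    rw [← Units.val_mul, ← map_mul, hb, map_one]; rfl
  have h3 : (s a).1 * (s b).1 = (s b).1 * (s a).1 := by
    rw [← Units.val_mul, ← Units.val_mul, ← map_mul, ← map_mul, hab]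
  exact absurd (aux_two (R := ZMod (2 ^ 2)) rfl _ _ x y hx hy h1 h2 h3) (by decide)

lemma one_add_pow_aux {R : Type*} [Ring R] (N : R) (h4 : N ^ 4 = 0) (k : ℕ) :
    (1 + N) ^ k = 1 + (k : R) * N + (k.choose 2 : R) * N ^ 2 + (k.choose 3 : R) * N ^ 3 := by
  induction k with
  | zero => simp
  | succ k ih =>
    rw [pow_succ, ih, Nat.choose_succ_succ' k 1, Nat.choose_succ_succ' k 2, Nat.choose_one_right]
    push_cast
    have : (k.choose 3 : R) * N ^ 3 * N = 0 := by rw [mul_assoc, ← pow_succ, h4, mul_zero]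
    have e2 : (k : R) * N * N = k * N ^ 2 := by rw [mul_assoc, ← sq]
    have e3 : (k.choose 2 : R) * N ^ 2 * N = k.choose 2 * N ^ 3 := by rw [mul_assoc, ← pow_succ]
    simp only [mul_add, add_mul, mul_one, one_mul, this, e2, e3]
    abel

lemma not_splits_big {p : ℕ} (hp : p.Prime) (h5 : 5 ≤ p) : ¬ GLSplits p 2 := by
  rintro ⟨s, hs⟩
  let a : GL (Fin 2) (ZMod p) := ⟨!![1, 1; 0, 1], !![1, -1; 0, 1],
    by simp [Matrix.one_fin_two], by simp [Matrix.one_fin_two]⟩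
  have hpow : ∀ k : ℕ, (!![1, 1; 0, 1] : Matrix (Fin 2) (Fin 2) (ZMod p)) ^ k =
      !![1, (k : ZMod p); 0, 1] := by
    intro k
    induction k with
    | zero => simp [Matrix.one_fin_two]
    | succ k ih => rw [pow_succ, ih]; simp [add_comm]
  have ha : a ^ p = 1 := by
    apply Units.ext
    rw [Units.val_pow_eq_pow_val]
    refine (hpow p).trans ?_
    simp [Matrix.one_fin_two]
  obtain ⟨x, hx⟩ := sec_entry' hp hs a !![1, 1; 0, 1] (by
    intro i j
    change (!![1, 1; 0, 1] : Matrix (Fin 2) (Fin 2) (ZMod p)) i j = _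
    fin_cases i <;> fin_cases j <;> simp)
  have h1 : (s a).1 ^ p = 1 := by
    rw [← Units.val_pow_eq_pow_val, ← map_pow, ha, map_one, Units.val_one]
  have hpp := p_mul_p p
  set q : ZMod (p ^ 2) := (p : ZMod (p ^ 2)) with hq
  let N : Matrix (Fin 2) (Fin 2) (ZMod (p ^ 2)) :=
    !![q * x 0 0, 1 + q * x 0 1; q * x 1 0, q * x 1 1]
  have hN : (s a).1 = 1 + N := by
    ext i j
    rw [hx]
    fin_cases i <;> fin_cases j <;> simp [N]
  have hN2 : N ^ 2 = q • !![x 1 0, x 0 0 + x 1 1; 0, x 1 0] := by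
    ext i j
    fin_cases i <;> fin_cases j <;> simp [N, pow_two N, Matrix.mul_apply, Fin.sum_univ_two] <;> grind
  have hqN : q • N ^ 2 = 0 := by rw [hN2, smul_smul, hpp, zero_smul]
  have hN4 : N ^ 4 = 0 := by
    rw [show 4 = 2 + 2 from rfl, pow_add, hN2, smul_mul_smul_comm, hpp, zero_smul]
  have hz : ∀ m : ℕ, p ∣ m → (m : Matrix (Fin 2) (Fin 2) (ZMod (p ^ 2))) * N ^ 2 = 0 := by
    rintro m ⟨c, rfl⟩
    rw [← nsmul_eq_mul, mul_comm, mul_smul, ← Nat.cast_smul_eq_nsmul (ZMod (p ^ 2)) p, hqN,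
      smul_zero]
  rw [hN, one_add_pow_aux N hN4, pow_succ N 2, ← mul_assoc,
    hz _ (hp.dvd_choose_self (by norm_num) (by omega)),
    hz _ (hp.dvd_choose_self (by norm_num) (by omega)), zero_mul, add_zero, add_zero] at h1
  have h2 : (p : Matrix (Fin 2) (Fin 2) (ZMod (p ^ 2))) * N = 0 := by
    simpa using h1
  rw [← nsmul_eq_mul, ← Nat.cast_smul_eq_nsmul (ZMod (p ^ 2)) p] at h2
  have h3 := congrFun (congrFun h2 0) 1
  have h4 : q = 0 := by
    simp [N] at h3
    grind
  rw [hq, ZMod.natCast_eq_zero_iff] at h4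
  have := Nat.le_of_dvd hp.pos h4
  nlinarith

theorem gl_mod_square_splits_iff (p n : ℕ) (hp : p.Prime) (hn : 2 ≤ n) :
    (∃ s : GL (Fin n) (ZMod p) →* GL (Fin n) (ZMod (p ^ 2)),
        (glModSquareReduction p n).comp s = MonoidHom.id (GL (Fin n) (ZMod p))) ↔
      ((p = 3 ∧ n = 2) ∨ (p = 2 ∧ n = 2) ∨ (p = 2 ∧ n = 3)) := by
  constructor
  · intro h
    have h : GLSplits p n := h
    have hp2 := hp.two_le
    by_cases h5 : 5 ≤ p
    · exact absurd (h.mono hp hn) (not_splits_big hp h5)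
    · have hp4 : p ≠ 4 := by rintro rfl; revert hp; norm_num
      obtain rfl | rfl : p = 2 ∨ p = 3 := by omega
      · have : n < 4 := by
          by_contra hc
          exact not_splits_two (h.mono hp (by omega))
        omega
      · have : n < 3 := by
          by_contra hc
          exact not_splits_three (h.mono hp (by omega))
        omega
  · rintro (⟨rfl, rfl⟩ | ⟨rfl, rfl⟩ | ⟨rfl, rfl⟩)
    · exact split_three_two
    · exact GLSplits.mono hp (by norm_num) split_two_three
    · exact split_two_three
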